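/- arXiv:0908.4537 — 4 statements merged into one kernel-verified Lean document; each statement's English description precedes it below -/
import Mathlib

section
/- For every mass m > 0, every vector k ∈ ℝ³ and every real x₄ > 0, one has (1/(2ω(k))) · e^{−ω(k)·x₄} = (1/(2π)) · ∫_{ℝ} e^{i k₄ x₄} / (|k|² + k₄² + m²) dk₄, where ω(k) = √(|k|² + m²) and the integral on the right converges (as a Lebesgue integral of a complex-valued function of k₄ ∈ ℝ, whose value is the real number on the left). -/
open MeasureTheory

/-- The on-shell energy `ω(k) = √(|k|² + m²)` for `k ∈ ℝ³`. -/
noncomputable def omega (m : ℝ) (k : Fin 3 → ℝ) : ℝ :=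
  Real.sqrt ((∑ i, k i ^ 2) + m ^ 2)

open scoped FourierTransform

theorem exp_neg_mul_abs_eqOn_Ioi (a c : ℂ) :
    Set.EqOn (fun t : ℝ => Complex.exp (c * t) * Complex.exp (-a * (|t| : ℝ)))
      (fun t : ℝ => Complex.exp ((c - a) * t)) (Set.Ioi 0) := by
  intro t ht
  simp only [abs_of_pos (Set.mem_Ioi.mp ht), ← Complex.exp_add]
  ring_nf

theorem exp_neg_mul_abs_eqOn_Iic (a c : ℂ) :
    Set.EqOn (fun t : ℝ => Complex.exp (c * t) * Complex.exp (-a * (|t| : ℝ)))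
      (fun t : ℝ => Complex.exp ((c + a) * t)) (Set.Iic 0) := by
  intro t ht
  simp only [abs_of_nonpos (Set.mem_Iic.mp ht), ← Complex.exp_add, Complex.ofReal_neg]
  ring_nf

theorem integrableOn_Ioi_exp_mul_exp_neg_mul_abs {a c : ℂ} (h : c.re < a.re) :
    IntegrableOn (fun t : ℝ => Complex.exp (c * t) * Complex.exp (-a * (|t| : ℝ)))
      (Set.Ioi 0) :=
  (integrableOn_exp_mul_complex_Ioi (by simpa using h) 0).congr_fun
    (exp_neg_mul_abs_eqOn_Ioi a c).symm measurableSet_Ioi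

theorem integrableOn_Iic_exp_mul_exp_neg_mul_abs {a c : ℂ} (h : -a.re < c.re) :
    IntegrableOn (fun t : ℝ => Complex.exp (c * t) * Complex.exp (-a * (|t| : ℝ)))
      (Set.Iic 0) :=
  (integrableOn_exp_mul_complex_Iic (by rw [Complex.add_re]; linarith) 0).congr_fun
    (exp_neg_mul_abs_eqOn_Iic a c).symm measurableSet_Iic

theorem integral_exp_mul_exp_neg_mul_abs {a c : ℂ} (h₁ : -a.re < c.re) (h₂ : c.re < a.re) :
    ∫ t : ℝ, Complex.exp (c * t) * Complex.exp (-a * (|t| : ℝ)) = 2 * a / (a ^ 2 - c ^ 2) := by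
  have hs : 0 < (c + a).re := by rw [Complex.add_re]; linarith
  have hd : (c - a).re < 0 := by rw [Complex.sub_re]; linarith
  have hs' : c + a ≠ 0 := fun h => by simp [h] at hs
  have hd' : c - a ≠ 0 := fun h => by simp [h] at hd
  have hsd : a ^ 2 - c ^ 2 ≠ 0 := by
    rw [show a ^ 2 - c ^ 2 = -((c + a) * (c - a)) by ring]
    exact neg_ne_zero.mpr (mul_ne_zero hs' hd')
  rw [← intervalIntegral.integral_Iic_add_Ioi
      (integrableOn_Iic_exp_mul_exp_neg_mul_abs h₁)
      (integrableOn_Ioi_exp_mul_exp_neg_mul_abs h₂),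
    setIntegral_congr_fun measurableSet_Iic (exp_neg_mul_abs_eqOn_Iic a c),
    setIntegral_congr_fun measurableSet_Ioi (exp_neg_mul_abs_eqOn_Ioi a c),
    integral_exp_mul_complex_Iic hs, integral_exp_mul_complex_Ioi hd]
  simp only [Complex.ofReal_zero, mul_zero, Complex.exp_zero]
  field_simp
  ring

theorem integrable_exp_neg_mul_abs {a : ℝ} (ha : 0 < a) :
    Integrable (fun t : ℝ => Complex.exp (-(a : ℂ) * (|t| : ℝ))) := by
  have h := (integrableOn_Iic_exp_mul_exp_neg_mul_abs (a := a) (c := 0) (by simpa)).union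
    (integrableOn_Ioi_exp_mul_exp_neg_mul_abs (a := a) (c := 0) (by simpa))
  rw [Set.Iic_union_Ioi, integrableOn_univ] at h
  simpa using h

theorem fourier_exp_neg_mul_abs {a : ℝ} (ha : 0 < a) (w : ℝ) :
    𝓕 (fun t : ℝ => Complex.exp (-(a : ℂ) * (|t| : ℝ))) w =
      2 * a / ((a ^ 2 + (2 * Real.pi * w) ^ 2 : ℝ) : ℂ) := by
  rw [Real.fourier_real_eq_integral_exp_smul]
  have h := integral_exp_mul_exp_neg_mul_abs (a := a)
    (c := ((-2 * Real.pi * w : ℝ) : ℂ) * Complex.I) (by simpa) (by simpa)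
  convert h using 1
  · congr 1 with t
    rw [smul_eq_mul]
    push_cast
    ring_nf
  · rw [mul_pow _ Complex.I, Complex.I_sq]
    push_cast
    ring_nf

theorem integrable_exp_I_mul_div_sq_add_sq {a : ℝ} (ha : 0 < a) (x : ℝ) :
    Integrable (fun p : ℝ =>
      Complex.exp (Complex.I * p * x) / ((a ^ 2 + p ^ 2 : ℝ) : ℂ)) := by
  have hpos (p : ℝ) : 0 < a ^ 2 + p ^ 2 := by positivity
  have hr : Integrable (fun p : ℝ => (a ^ 2 + p ^ 2)⁻¹) := by
    refine ((integrable_inv_one_add_sq.comp_div ha.ne').const_mul (a ^ 2)⁻¹).congr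
      (.of_forall fun p => ?_)
    have := hpos p
    simp only
    rw [← mul_inv]
    congr 1
    field_simp
  refine hr.mono' ?_ (.of_forall fun p => ?_)
  · refine Continuous.aestronglyMeasurable (Continuous.div (by fun_prop) (by fun_prop) fun p => ?_)
    exact_mod_cast (hpos p).ne'
  · rw [norm_div, Complex.norm_real, Real.norm_of_nonneg (hpos p).le, Complex.norm_exp]
    simp

theorem integral_exp_I_mul_div_sq_add_sq {a : ℝ} (ha : 0 < a) (x : ℝ) :
    ∫ p : ℝ, Complex.exp (Complex.I * p * x) / ((a ^ 2 + p ^ 2 : ℝ) : ℂ) =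
      Real.pi / a * Complex.exp (-(a : ℂ) * (|x| : ℝ)) := by
  have hF : 𝓕 (fun t : ℝ => Complex.exp (-(a : ℂ) * (|t| : ℝ))) =
      fun w : ℝ => 2 * a / ((a ^ 2 + (2 * Real.pi * w) ^ 2 : ℝ) : ℂ) :=
    funext (fourier_exp_neg_mul_abs ha)
  have hFint : Integrable (𝓕 (fun t : ℝ => Complex.exp (-(a : ℂ) * (|t| : ℝ)))) := by
    rw [hF]
    have h := ((integrable_exp_I_mul_div_sq_add_sq ha 0).comp_mul_left'
      Real.two_pi_pos.ne').const_mul (2 * a : ℂ)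
    simpa [mul_one_div, ← div_eq_mul_inv] using h
  have hinv := congrFun (Continuous.fourierInv_fourier_eq
    (by fun_prop) (integrable_exp_neg_mul_abs ha) hFint) x
  have hscale := Measure.integral_comp_mul_left (fun p : ℝ =>
    Complex.exp (Complex.I * p * x) / ((a ^ 2 + p ^ 2 : ℝ) : ℂ)) (2 * Real.pi)
  have hI : ∫ w : ℝ, Complex.exp ((2 * Real.pi * (w * x) : ℝ) * Complex.I) *
        (2 * a / ((a ^ 2 + (2 * Real.pi * w) ^ 2 : ℝ) : ℂ)) =
      2 * a * ∫ w : ℝ, Complex.exp (Complex.I * (2 * Real.pi * w : ℝ) * x) /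
        ((a ^ 2 + (2 * Real.pi * w) ^ 2 : ℝ) : ℂ) := by
    rw [← integral_const_mul]
    congr 1 with w
    rw [show ((2 * Real.pi * (w * x) : ℝ) : ℂ) * Complex.I =
      Complex.I * (2 * Real.pi * w : ℝ) * x by push_cast; ring]
    ring
  rw [hF, Real.fourierInv_eq'] at hinv
  simp only [smul_eq_mul, RCLike.inner_apply, conj_trivial, mul_comm x] at hinv
  rw [hI, hscale, abs_of_pos (inv_pos.mpr Real.two_pi_pos), Complex.real_smul] at hinv
  rw [← hinv, Complex.ofReal_inv, Complex.ofReal_mul, Complex.ofReal_ofNat]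
  have : (a : ℂ) ≠ 0 := by exact_mod_cast ha.ne'
  have : (Real.pi : ℂ) ≠ 0 := by exact_mod_cast Real.pi_ne_zero
  generalize (∫ p : ℝ, _ : ℂ) = J
  field_simp

/-- For every mass `m > 0`, every `k ∈ ℝ³` and every `x₄ > 0`,
`(1/(2ω(k))) e^{−ω(k)x₄} = (1/(2π)) ∫_ℝ e^{i k₄ x₄}/(|k|² + k₄² + m²) dk₄`,
the integral on the right converging as a Lebesgue (Bochner) integral. -/
theorem schwinger_identity (m : ℝ) (hm : 0 < m) (k : Fin 3 → ℝ) (x₄ : ℝ) (hx₄ : 0 < x₄) :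
    Integrable (fun k₄ : ℝ =>
      Complex.exp (Complex.I * (k₄ : ℂ) * (x₄ : ℂ)) /
        ((((∑ i, k i ^ 2) + k₄ ^ 2 + m ^ 2 : ℝ) : ℂ))) ∧
    (((1 / (2 * omega m k)) * Real.exp (-(omega m k) * x₄) : ℝ) : ℂ) =
      ((1 / (2 * Real.pi) : ℝ) : ℂ) *
        ∫ k₄ : ℝ, Complex.exp (Complex.I * (k₄ : ℂ) * (x₄ : ℂ)) /
          ((((∑ i, k i ^ 2) + k₄ ^ 2 + m ^ 2 : ℝ) : ℂ)) := by
  have hrad : 0 < (∑ i, k i ^ 2) + m ^ 2 := by positivity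
  have hω : 0 < omega m k := Real.sqrt_pos.mpr hrad
  have hden (p : ℝ) : (∑ i, k i ^ 2) + p ^ 2 + m ^ 2 = omega m k ^ 2 + p ^ 2 := by
    rw [omega, Real.sq_sqrt hrad.le]
    ring
  simp only [hden]
  refine ⟨integrable_exp_I_mul_div_sq_add_sq hω x₄, ?_⟩
  rw [integral_exp_I_mul_div_sq_add_sq hω, abs_of_pos hx₄]
  have : (omega m k : ℂ) ≠ 0 := by exact_mod_cast hω.ne'
  have : (Real.pi : ℂ) ≠ 0 := by exact_mod_cast Real.pi_ne_zero
  push_cast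
  field_simp
end

section
/- Let T = {z = (z₀, z⃗) ∈ ℂ × ℂ³ : −Im z₀ > |Im z⃗|}, where |Im z⃗| is the Euclidean norm of the vector of imaginary parts of the three components of z⃗. Then for every z ∈ T the function k ↦ e^{−i ω(k) z₀ + i⟨k, z⃗⟩} / (2ω(k)) is Lebesgue integrable on ℝ³, and the function f(z) = (2π)^{−3} ∫_{ℝ³} e^{−i ω(k) z₀ + i⟨k, z⃗⟩} / (2ω(k)) dk is holomorphic (complex analytic) on the open set T ⊆ ℂ⁴. -/
open MeasureTheory

/-- The tube `T = ℝ⁴ − iΓ₊ = {z = (z₀, z⃗) ∈ ℂ × ℂ³ : −Im z₀ > |Im z⃗|}`. -/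
noncomputable def tube : Set (ℂ × (Fin 3 → ℂ)) :=
  {z | Real.sqrt (∑ i, (z.2 i).im ^ 2) < -z.1.im}

/-- The analytic function `f(z) = (2π)⁻³ ∫_{ℝ³} e^{−iω(k)z₀ + i⟨k,z⃗⟩}/(2ω(k)) dk`
whose boundary value is the two-point function `Δ₊`. -/
noncomputable def fAna (m : ℝ) (z : ℂ × (Fin 3 → ℂ)) : ℂ :=
  ((((2 * Real.pi) ^ 3)⁻¹ : ℝ) : ℂ) *
    ∫ k : Fin 3 → ℝ,
      Complex.exp (-Complex.I * (omega m k : ℂ) * z.1 +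
          Complex.I * ∑ i, (k i : ℂ) * z.2 i) /
        (2 * (omega m k : ℂ))

lemma continuous_omega (m : ℝ) : Continuous (omega m) := by
  unfold omega
  fun_prop

lemma le_omega {m : ℝ} (k : Fin 3 → ℝ) : m ≤ omega m k :=
  Real.le_sqrt_of_sq_le (le_add_of_nonneg_left (Finset.sum_nonneg fun i _ => sq_nonneg (k i)))

lemma sqrt_sum_sq_le_omega (m : ℝ) (k : Fin 3 → ℝ) : Real.sqrt (∑ i, k i ^ 2) ≤ omega m k :=
  Real.sqrt_le_sqrt (by nlinarith [sq_nonneg m])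

lemma abs_apply_le_omega (m : ℝ) (k : Fin 3 → ℝ) (i : Fin 3) : |k i| ≤ omega m k := by
  refine (Real.abs_le_sqrt ?_).trans (sqrt_sum_sq_le_omega m k)
  exact Finset.single_le_sum (f := fun j => k j ^ 2) (fun j _ => sq_nonneg _) (Finset.mem_univ i)

lemma integrable_exp_neg_mul_abs_s1 {c : ℝ} (hc : 0 < c) :
    Integrable fun x : ℝ => Real.exp (-c * |x|) := by
  rw [← integrableOn_univ, ← Set.Iic_union_Ioi (a := (0 : ℝ))]
  refine .union ?_ ?_
  · refine (integrableOn_exp_mul_Iic hc 0).congr_fun (fun x hx => ?_) measurableSet_Iic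
    simp [abs_of_nonpos (Set.mem_Iic.1 hx)]
  · refine (integrableOn_exp_mul_Ioi (neg_neg_of_pos hc) 0).congr_fun (fun x hx => ?_)
      measurableSet_Ioi
    simp [abs_of_pos (Set.mem_Ioi.1 hx)]

lemma integrable_exp_neg_mul_omega (m : ℝ) {c : ℝ} (hc : 0 < c) :
    Integrable fun k : Fin 3 → ℝ => Real.exp (-c * omega m k) := by
  have h : Integrable fun k : Fin 3 → ℝ => ∏ i, Real.exp (-(c / 3) * |k i|) :=
    Integrable.fintype_prod (f := fun _ x => Real.exp (-(c / 3) * |x|))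
      fun _ => integrable_exp_neg_mul_abs_s1 (by positivity)
  refine h.mono' (by have := continuous_omega m; fun_prop) (.of_forall fun k => ?_)
  rw [Real.norm_of_nonneg (Real.exp_nonneg _), ← Real.exp_sum, Real.exp_le_exp,
    Fin.sum_univ_three]
  have h0 := abs_apply_le_omega m k 0
  have h1 := abs_apply_le_omega m k 1
  have h2 := abs_apply_le_omega m k 2
  nlinarith

/-- The exponent `-iω(k)z₀ + i⟨k, z⃗⟩` as a continuous linear functional of `z`. -/
noncomputable def phase (m : ℝ) (k : Fin 3 → ℝ) : ℂ × (Fin 3 → ℂ) →L[ℂ] ℂ :=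
  (-Complex.I * (omega m k : ℂ)) • ContinuousLinearMap.fst ℂ ℂ (Fin 3 → ℂ) +
    Complex.I • ∑ i, (k i : ℂ) •
      (ContinuousLinearMap.proj i).comp (ContinuousLinearMap.snd ℂ ℂ (Fin 3 → ℂ))

lemma phase_apply (m : ℝ) (k : Fin 3 → ℝ) (z : ℂ × (Fin 3 → ℂ)) :
    phase m k z = -Complex.I * (omega m k : ℂ) * z.1 + Complex.I * ∑ i, (k i : ℂ) * z.2 i := by
  simp [phase]

lemma continuous_phase (m : ℝ) : Continuous (phase m) := by
  have := continuous_omega m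
  unfold phase
  fun_prop

lemma norm_phase_le (m : ℝ) (k : Fin 3 → ℝ) : ‖phase m k‖ ≤ 4 * omega m k := by
  have hω : 0 ≤ omega m k := Real.sqrt_nonneg _
  refine ContinuousLinearMap.opNorm_le_bound _ (by positivity) fun z => ?_
  have h1 : ‖-Complex.I * (omega m k : ℂ) * z.1‖ ≤ omega m k * ‖z‖ := by
    simpa [abs_of_nonneg hω] using mul_le_mul_of_nonneg_left (norm_fst_le z) hω
  have h2 : ‖Complex.I * ∑ i, (k i : ℂ) * z.2 i‖ ≤ ∑ _i : Fin 3, omega m k * ‖z‖ := by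
    rw [norm_mul, Complex.norm_I, one_mul]
    refine norm_sum_le_of_le _ fun i _ => ?_
    rw [norm_mul, Complex.norm_real, Real.norm_eq_abs]
    exact mul_le_mul (abs_apply_le_omega m k i) ((norm_le_pi_norm _ i).trans (norm_snd_le z))
      (norm_nonneg _) hω
  rw [Finset.sum_const, Finset.card_fin, nsmul_eq_mul, Nat.cast_ofNat] at h2
  rw [phase_apply]
  linarith [norm_add_le (-Complex.I * (omega m k : ℂ) * z.1) (Complex.I * ∑ i, (k i : ℂ) * z.2 i)]

/-- The amount `-Im z₀ - |Im z⃗|` by which `z` lies inside the tube. -/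
noncomputable def tubeDepth (z : ℂ × (Fin 3 → ℂ)) : ℝ :=
  -z.1.im - Real.sqrt (∑ i, (z.2 i).im ^ 2)

lemma continuous_tubeDepth : Continuous tubeDepth := by
  unfold tubeDepth
  fun_prop

lemma re_phase_le (m : ℝ) (k : Fin 3 → ℝ) (z : ℂ × (Fin 3 → ℂ)) :
    (phase m k z).re ≤ -tubeDepth z * omega m k := by
  have hre : (phase m k z).re = omega m k * z.1.im + ∑ i, -k i * (z.2 i).im := by
    rw [phase_apply]
    simp
  have hcs := Real.sum_mul_le_sqrt_mul_sqrt Finset.univ (fun i => -k i) (fun i => (z.2 i).im)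
  simp only [neg_sq] at hcs
  have := mul_le_mul_of_nonneg_right (sqrt_sum_sq_le_omega m k)
    (Real.sqrt_nonneg (∑ i, (z.2 i).im ^ 2))
  rw [hre, tubeDepth]
  linarith

lemma norm_exp_phase_le {m c : ℝ} (k : Fin 3 → ℝ) {z : ℂ × (Fin 3 → ℂ)} (hz : c ≤ tubeDepth z) :
    ‖Complex.exp (phase m k z)‖ ≤ Real.exp (-c * omega m k) := by
  rw [Complex.norm_exp, Real.exp_le_exp]
  refine (re_phase_le m k z).trans ?_
  exact mul_le_mul_of_nonneg_right (neg_le_neg hz) (Real.sqrt_nonneg _)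

lemma continuous_exp_phase_div {m : ℝ} (hm : 0 < m) (z : ℂ × (Fin 3 → ℂ)) :
    Continuous fun k => Complex.exp (phase m k z) / (2 * (omega m k : ℂ)) := by
  have hω := continuous_omega m
  have hp := continuous_phase m
  refine Continuous.div (by fun_prop) (by fun_prop) fun k => ?_
  have : omega m k ≠ 0 := (hm.trans_le (le_omega k)).ne'
  simpa using this

lemma integrable_exp_phase_div {m : ℝ} (hm : 0 < m) {z : ℂ × (Fin 3 → ℂ)} (hz : z ∈ tube) :
    Integrable fun k => Complex.exp (phase m k z) / (2 * (omega m k : ℂ)) := by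
  have hz' : 0 < tubeDepth z := sub_pos.2 hz
  refine ((integrable_exp_neg_mul_omega m hz').div_const (2 * m)).mono'
    (continuous_exp_phase_div hm z).aestronglyMeasurable (.of_forall fun k => ?_)
  have hω := le_omega (m := m) k
  rw [norm_div, norm_mul, Complex.norm_ofNat, Complex.norm_real,
    Real.norm_of_nonneg (hm.le.trans hω)]
  gcongr
  exact norm_exp_phase_le k le_rfl

lemma differentiableAt_integral_exp_phase_div {m : ℝ} (hm : 0 < m) {z : ℂ × (Fin 3 → ℂ)}
    (hz : z ∈ tube) :
    DifferentiableAt ℂ (fun z => ∫ k, Complex.exp (phase m k z) / (2 * (omega m k : ℂ))) z := by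
  have hz' : 0 < tubeDepth z := sub_pos.2 hz
  have hs : {w | tubeDepth z / 2 < tubeDepth w} ∈ nhds z :=
    (isOpen_lt continuous_const continuous_tubeDepth).mem_nhds (half_lt_self hz')
  refine (hasFDerivAt_integral_of_dominated_of_fderiv_le
    (F := fun w k => Complex.exp (phase m k w) / (2 * (omega m k : ℂ)))
    (F' := fun w k => (Complex.exp (phase m k w) / (2 * (omega m k : ℂ))) • phase m k)
    (bound := fun k => 2 * Real.exp (-(tubeDepth z / 2) * omega m k)) hs
    (.of_forall fun w => (continuous_exp_phase_div hm w).aestronglyMeasurable)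
    (integrable_exp_phase_div hm hz)
    ((continuous_exp_phase_div hm z).smul (continuous_phase m)).aestronglyMeasurable
    (.of_forall fun k w hw => ?_)
    ((integrable_exp_neg_mul_omega m (half_pos hz')).const_mul 2)
    (.of_forall fun k w _ => ?_)).differentiableAt
  · have hω : 0 < omega m k := hm.trans_le (le_omega k)
    have hexp : ‖Complex.exp (phase m k w)‖ ≤ Real.exp (-(tubeDepth z / 2) * omega m k) :=
      norm_exp_phase_le k (le_of_lt hw)
    rw [norm_smul, norm_div, norm_mul, Complex.norm_ofNat, Complex.norm_real,
      Real.norm_of_nonneg hω.le]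
    calc ‖Complex.exp (phase m k w)‖ / (2 * omega m k) * ‖phase m k‖
        ≤ Real.exp (-(tubeDepth z / 2) * omega m k) / (2 * omega m k) * (4 * omega m k) := by
          gcongr
          exact norm_phase_le m k
      _ = 2 * Real.exp (-(tubeDepth z / 2) * omega m k) := by
          field_simp
          ring
  · have h := ((phase m k).hasFDerivAt (x := w)).cexp.mul_const (2 * (omega m k : ℂ))⁻¹
    simpa only [div_eq_mul_inv, smul_smul, mul_comm] using h

/-- For every `z` in the tube `T`, the integrand defining `f` is Lebesgue integrable on `ℝ³`,
and `f` is holomorphic on the open set `T ⊆ ℂ⁴`. -/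
theorem fAna_integrable_and_holomorphic (m : ℝ) (hm : 0 < m) :
    (∀ z ∈ tube, Integrable (fun k : Fin 3 → ℝ =>
      Complex.exp (-Complex.I * (omega m k : ℂ) * z.1 +
          Complex.I * ∑ i, (k i : ℂ) * z.2 i) /
        (2 * (omega m k : ℂ)))) ∧
    DifferentiableOn ℂ (fAna m) tube := by
  have hF : ∀ (z : ℂ × (Fin 3 → ℂ)) (k : Fin 3 → ℝ),
      -Complex.I * (omega m k : ℂ) * z.1 + Complex.I * ∑ i, (k i : ℂ) * z.2 i = phase m k z :=
    fun z k => (phase_apply m k z).symm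
  refine ⟨fun z hz => ?_, fun z hz => ?_⟩
  · simp only [hF]
    exact integrable_exp_phase_div hm hz
  · unfold fAna
    simp only [hF]
    exact ((differentiableAt_integral_exp_phase_div hm hz).const_mul _).differentiableWithinAt
end

section
/- The two-point function Δ₊ solves the Klein–Gordon equation in the sense of distributions: for every Schwartz function g on ℝ⁴, Δ₊( ∂²g/∂x₀² − Δ_{x⃗} g + m² g ) = 0, where Δ_{x⃗} denotes the Laplacian in the three spatial variables. -/
open MeasureTheory

/-- The two-point function `Δ₊` of the free scalar field of mass `m`, as a functional:
`Δ₊(g) = (2π)⁻³ ∫_{ℝ³} (1/(2ω(k))) ∫_{ℝ⁴} g(x₀,x⃗) e^{−iω(k)x₀ + i⟨k,x⃗⟩} dx dk`. -/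
noncomputable def twoPoint (m : ℝ) (g : (ℝ × (Fin 3 → ℝ)) → ℂ) : ℂ :=
  ((((2 * Real.pi) ^ 3)⁻¹ : ℝ) : ℂ) *
    ∫ k : Fin 3 → ℝ, (((2 * omega m k)⁻¹ : ℝ) : ℂ) *
      ∫ x : ℝ × (Fin 3 → ℝ),
        g x * Complex.exp (-Complex.I * (omega m k : ℂ) * (x.1 : ℂ) +
          Complex.I * ∑ i, (k i : ℂ) * (x.2 i : ℂ))

/-- Directional derivative of a function on `ℝ⁴ = ℝ × ℝ³` in direction `v`. -/
noncomputable def dirDeriv (v : ℝ × (Fin 3 → ℝ)) (g : (ℝ × (Fin 3 → ℝ)) → ℂ)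
    (x : ℝ × (Fin 3 → ℝ)) : ℂ :=
  deriv (fun t : ℝ => g (x + t • v)) 0

/-- The time direction `e₀ = (1, 0)` in `ℝ⁴ = ℝ × ℝ³`. -/
noncomputable def e₀ : ℝ × (Fin 3 → ℝ) := (1, 0)

/-- The spatial coordinate directions `eᵢ = (0, δᵢ)` in `ℝ⁴ = ℝ × ℝ³`. -/
noncomputable def eSpace (i : Fin 3) : ℝ × (Fin 3 → ℝ) := (0, Pi.single i 1)

/-- The Klein–Gordon operator `∂²/∂x₀² − Δ_{x⃗} + m²` applied to `g`. -/
noncomputable def kleinGordon (m : ℝ) (g : (ℝ × (Fin 3 → ℝ)) → ℂ)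
    (x : ℝ × (Fin 3 → ℝ)) : ℂ :=
  dirDeriv e₀ (dirDeriv e₀ g) x - (∑ i, dirDeriv (eSpace i) (dirDeriv (eSpace i) g) x) +
    (m ^ 2 : ℝ) * g x

open scoped LineDeriv SchwartzMap

section Oscillatory

variable {V : Type*} [NormedAddCommGroup V] [NormedSpace ℝ V] [FiniteDimensional ℝ V]
  [MeasurableSpace V] [BorelSpace V]

/-- A Schwartz function times a plane wave is integrable. -/
theorem SchwartzMap.integrable_mul_planeWave (μ : Measure V) [μ.IsAddHaarMeasure]
    (φ : V →L[ℝ] ℝ) (g : 𝓢(V, ℂ)) :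
    Integrable (fun x ↦ g x * Complex.exp (φ x * Complex.I)) μ :=
  g.integrable.mul_bdd (c := 1) (by fun_prop)
    (.of_forall fun x ↦ (Complex.norm_exp_ofReal_mul_I (φ x)).le)

/-- Integrating by parts against a plane wave turns a directional derivative into a
multiplication. -/
theorem SchwartzMap.integral_lineDerivOp_mul_planeWave (μ : Measure V) [μ.IsAddHaarMeasure]
    (φ : V →L[ℝ] ℝ) (g : 𝓢(V, ℂ)) (v : V) :
    ∫ x, (∂_{v} g) x * Complex.exp (φ x * Complex.I) ∂μ =
      -(φ v * Complex.I) * ∫ x, g x * Complex.exp (φ x * Complex.I) ∂μ := by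
  have hderiv (x : V) : HasLineDerivAt ℝ (fun x ↦ Complex.exp (φ x * Complex.I))
      (Complex.exp (φ x * Complex.I) * (φ v * Complex.I)) x v := by
    have h := ((Complex.ofRealCLM.hasFDerivAt.comp x φ.hasFDerivAt).mul_const Complex.I).cexp
    simpa [mul_comm, mul_left_comm] using! h.hasLineDerivAt v
  have hint := g.integrable_mul_planeWave μ φ
  have hg (x : V) : HasLineDerivAt ℝ g ((∂_{v} g) x) x v := by
    rw [SchwartzMap.lineDerivOp_apply]
    exact g.differentiableAt.lineDifferentiableAt.hasLineDerivAt
  have hparts := integral_bilinear_hasLineDerivAt_right_eq_neg_left_of_integrable (μ := μ)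
    (B := ContinuousLinearMap.mul ℝ ℂ) (f := g) (f' := ⇑(∂_{v} g : 𝓢(V, ℂ))) (v := v)
    (g := fun x ↦ Complex.exp (φ x * Complex.I))
    (g' := fun x ↦ Complex.exp (φ x * Complex.I) * (φ v * Complex.I))
    (SchwartzMap.integrable_mul_planeWave μ φ (∂_{v} g))
    (by simpa [mul_assoc] using hint.mul_const (φ v * Complex.I)) hint
    (fun x _ ↦ hg x) (fun x _ ↦ hderiv x)
  simp only [ContinuousLinearMap.mul_apply', ← mul_assoc, integral_mul_const] at hparts
  linear_combination hparts

/-- The second directional derivative has symbol `-(φ v)²` on the plane wave of phase `φ`. -/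
theorem SchwartzMap.integral_lineDerivOp_lineDerivOp_mul_planeWave (μ : Measure V)
    [μ.IsAddHaarMeasure] (φ : V →L[ℝ] ℝ) (g : 𝓢(V, ℂ)) (v : V) :
    ∫ x, (∂_{v} (∂_{v} g)) x * Complex.exp (φ x * Complex.I) ∂μ =
      -(φ v : ℂ) ^ 2 * ∫ x, g x * Complex.exp (φ x * Complex.I) ∂μ := by
  rw [integral_lineDerivOp_mul_planeWave, integral_lineDerivOp_mul_planeWave]
  linear_combination (φ v : ℂ) ^ 2 *
    (∫ x, g x * Complex.exp (φ x * Complex.I) ∂μ) * Complex.I_sq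

end Oscillatory

theorem dirDeriv_schwartz (v : ℝ × (Fin 3 → ℝ)) (g : 𝓢(ℝ × (Fin 3 → ℝ), ℂ)) :
    dirDeriv v g = ∂_{v} g :=
  funext fun x ↦ (SchwartzMap.lineDerivOp_apply v g x).symm

theorem omega_sq (m : ℝ) (k : Fin 3 → ℝ) : omega m k ^ 2 = (∑ i, k i ^ 2) + m ^ 2 :=
  Real.sq_sqrt (by positivity)

/-- The phase `-ω(k) x₀ + ⟨k, x⃗⟩` of the positive-frequency plane wave with momentum `k`. -/
noncomputable def onShellPhase (m : ℝ) (k : Fin 3 → ℝ) : ℝ × (Fin 3 → ℝ) →L[ℝ] ℝ :=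
  -omega m k • ContinuousLinearMap.fst ℝ ℝ (Fin 3 → ℝ) +
    ∑ i, k i • (ContinuousLinearMap.proj i).comp (ContinuousLinearMap.snd ℝ ℝ (Fin 3 → ℝ))

theorem onShellPhase_apply (m : ℝ) (k : Fin 3 → ℝ) (x : ℝ × (Fin 3 → ℝ)) :
    onShellPhase m k x = -omega m k * x.1 + ∑ i, k i * x.2 i := by
  simp [onShellPhase]

theorem onShellPhase_e₀ (m : ℝ) (k : Fin 3 → ℝ) : onShellPhase m k e₀ = -omega m k := by
  simp [onShellPhase_apply, e₀]

theorem onShellPhase_eSpace (m : ℝ) (k : Fin 3 → ℝ) (i : Fin 3) :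
    onShellPhase m k (eSpace i) = k i := by
  simp [onShellPhase_apply, eSpace, Pi.single_apply]

/-- The Fourier transform of `kleinGordon m g` vanishes on the mass shell. -/
theorem integral_kleinGordon_mul_planeWave (m : ℝ) (k : Fin 3 → ℝ)
    (g : 𝓢(ℝ × (Fin 3 → ℝ), ℂ)) :
    ∫ x, kleinGordon m g x * Complex.exp (onShellPhase m k x * Complex.I) = 0 := by
  have : (volume : Measure (ℝ × (Fin 3 → ℝ))).IsAddHaarMeasure :=
    Measure.prod.instIsAddHaarMeasure volume volume
  have hint (f : 𝓢(ℝ × (Fin 3 → ℝ), ℂ)) := f.integrable_mul_planeWave volume (onShellPhase m k)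
  simp only [kleinGordon, dirDeriv_schwartz, add_mul, sub_mul, Finset.sum_mul, mul_assoc]
  have hsum := integrable_finsetSum Finset.univ fun i _ ↦ hint (∂_{eSpace i} (∂_{eSpace i} g))
  have htime := hint (∂_{e₀} (∂_{e₀} g))
  rw [integral_add (by exact htime.sub hsum) ((hint g).const_mul _), integral_sub htime hsum,
    integral_finsetSum _ fun i _ ↦ hint _, integral_const_mul]
  simp only [SchwartzMap.integral_lineDerivOp_lineDerivOp_mul_planeWave, onShellPhase_e₀,
    onShellPhase_eSpace, ← Finset.sum_mul, Finset.sum_neg_distrib]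
  have h := congrArg (fun r : ℝ ↦ (r : ℂ)) (omega_sq m k)
  push_cast at h ⊢
  linear_combination -(∫ x, g x * Complex.exp (onShellPhase m k x * Complex.I)) * h

/-- The two-point function `Δ₊` solves the Klein–Gordon equation in the sense of
distributions: `Δ₊(∂²g/∂x₀² − Δ_{x⃗}g + m²g) = 0` for every Schwartz function `g`. -/
theorem twoPoint_kleinGordon (m : ℝ) (hm : 0 < m)
    (g : SchwartzMap (ℝ × (Fin 3 → ℝ)) ℂ) :
    twoPoint m (kleinGordon m g) = 0 := by
  have h (k : Fin 3 → ℝ) : ∫ x, kleinGordon m g x *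
      Complex.exp (-Complex.I * (omega m k : ℂ) * (x.1 : ℂ) +
        Complex.I * ∑ i, (k i : ℂ) * (x.2 i : ℂ)) = 0 := by
    rw [← integral_kleinGordon_mul_planeWave m k g]
    congr! 4 with x
    rw [onShellPhase_apply]
    push_cast
    ring
  simp only [twoPoint, h, mul_zero, integral_zero]
end

section
/- Let T = {z ∈ ℂ⁴ : −Im z₀ > |Im z⃗|}. For every (z, w) ∈ T × T the function (k, p) ↦ e^{−i ω(k) z₀ + i⟨k, z⃗⟩} e^{−i ω(p) w₀ + i⟨p, w⃗⟩} / (4 ω(k) ω(p)) is Lebesgue integrable on ℝ³ × ℝ³, and the function f₂(z, w) = (2π)^{−6} ∫_{ℝ³×ℝ³} e^{−i ω(k) z₀ + i⟨k, z⃗⟩} e^{−i ω(p) w₀ + i⟨p, w⃗⟩} / (4 ω(k) ω(p)) dk dp is holomorphic on the open set T × T ⊆ ℂ⁸. -/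
open MeasureTheory

/-- The analytic function `f₂(z, w) = (2π)⁻⁶ ∫∫ e^{−iω(k)z₀+i⟨k,z⃗⟩} e^{−iω(p)w₀+i⟨p,w⃗⟩}
/(4ω(k)ω(p)) dk dp` whose boundary value is the tensor product `Δ₊⁽²⁾`. -/
noncomputable def f₂Ana (m : ℝ) (z w : ℂ × (Fin 3 → ℂ)) : ℂ :=
  ((((2 * Real.pi) ^ 6)⁻¹ : ℝ) : ℂ) *
    ∫ kp : (Fin 3 → ℝ) × (Fin 3 → ℝ),
      Complex.exp (-Complex.I * (omega m kp.1 : ℂ) * z.1 +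
          Complex.I * ∑ i, (kp.1 i : ℂ) * z.2 i) *
        Complex.exp (-Complex.I * (omega m kp.2 : ℂ) * w.1 +
          Complex.I * ∑ i, (kp.2 i : ℂ) * w.2 i) /
        (4 * (omega m kp.1 : ℂ) * (omega m kp.2 : ℂ))

namespace FreeField

lemma integrable_exp_neg_mul_abs {c : ℝ} (hc : 0 < c) :
    Integrable (fun x : ℝ => Real.exp (-c * |x|)) := by
  rw [← integrableOn_univ, ← Set.Iic_union_Ioi (a := (0 : ℝ))]
  refine IntegrableOn.union ?_ ?_
  · refine (integrableOn_exp_mul_Iic hc 0).congr_fun (fun x hx => ?_) measurableSet_Iic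
    simp [abs_of_nonpos (Set.mem_Iic.1 hx)]
  · refine (exp_neg_integrableOn_Ioi 0 hc).congr_fun (fun x hx => ?_) measurableSet_Ioi
    simp [abs_of_pos (Set.mem_Ioi.1 hx)]

lemma sqrt_sum_sq_le_omega (m : ℝ) (k : Fin 3 → ℝ) : Real.sqrt (∑ i, k i ^ 2) ≤ omega m k :=
  Real.sqrt_le_sqrt (le_add_of_nonneg_right (sq_nonneg m))

lemma abs_le_omega (m : ℝ) (k : Fin 3 → ℝ) (i : Fin 3) : |k i| ≤ omega m k := by
  refine le_trans ?_ (sqrt_sum_sq_le_omega m k)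
  rw [← Real.sqrt_sq_eq_abs]
  exact Real.sqrt_le_sqrt
    (Finset.single_le_sum (f := fun i => k i ^ 2) (fun _ _ => sq_nonneg _) (Finset.mem_univ i))

lemma sum_abs_le_omega (m : ℝ) (k : Fin 3 → ℝ) : ∑ i, |k i| ≤ 3 * omega m k := by
  simpa using Finset.sum_le_sum fun i (_ : i ∈ Finset.univ) => abs_le_omega m k i

lemma mass_le_omega (m : ℝ) (k : Fin 3 → ℝ) : m ≤ omega m k :=
  Real.le_sqrt_of_sq_le (le_add_of_nonneg_left (Finset.sum_nonneg fun _ _ => sq_nonneg _))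

lemma continuous_omega (m : ℝ) : Continuous (omega m) := by
  unfold omega
  fun_prop

lemma integrable_exp_neg_mul_omega (m : ℝ) {c : ℝ} (hc : 0 < c) :
    Integrable (fun k => Real.exp (-c * omega m k)) := by
  have h : Integrable (fun k : Fin 3 → ℝ => ∏ i, Real.exp (-(c / 3) * |k i|)) :=
    Integrable.fintype_prod fun _ => integrable_exp_neg_mul_abs (by positivity)
  refine h.mono' ?_ (ae_of_all _ fun k => ?_)
  · have := continuous_omega m
    exact Continuous.aestronglyMeasurable (by fun_prop)
  · rw [Real.norm_of_nonneg (Real.exp_pos _).le, ← Real.exp_sum, Real.exp_le_exp,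
      ← Finset.mul_sum]
    nlinarith [sum_abs_le_omega m k]

/-- The linear form `z ↦ −iω(k)z₀ + i⟨k, z⃗⟩` on `ℂ⁴`. -/
noncomputable def phase (m : ℝ) (k : Fin 3 → ℝ) : (ℂ × (Fin 3 → ℂ)) →L[ℂ] ℂ :=
  (-Complex.I * (omega m k : ℂ)) • ContinuousLinearMap.fst ℂ ℂ (Fin 3 → ℂ) +
    Complex.I • ∑ i, (k i : ℂ) •
      (ContinuousLinearMap.proj i).comp (ContinuousLinearMap.snd ℂ ℂ (Fin 3 → ℂ))

lemma phase_apply (m : ℝ) (k : Fin 3 → ℝ) (z : ℂ × (Fin 3 → ℂ)) :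
    phase m k z = -Complex.I * (omega m k : ℂ) * z.1 +
      Complex.I * ∑ i, (k i : ℂ) * z.2 i := by
  simp [phase]

lemma continuous_phase (m : ℝ) : Continuous (phase m) := by
  have := continuous_omega m
  unfold phase
  fun_prop

lemma norm_phase_le (m : ℝ) (k : Fin 3 → ℝ) : ‖phase m k‖ ≤ 4 * omega m k := by
  have hω : 0 ≤ omega m k := Real.sqrt_nonneg _
  refine ContinuousLinearMap.opNorm_le_bound _ (by positivity) fun z => ?_
  rw [phase_apply]
  have h1 : ‖-Complex.I * (omega m k : ℂ) * z.1‖ ≤ omega m k * ‖z‖ := by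
    simp only [norm_mul, norm_neg, Complex.norm_I, one_mul, Complex.norm_real,
      Real.norm_of_nonneg hω]
    gcongr
    exact norm_fst_le z
  have h2 : ‖Complex.I * ∑ i, (k i : ℂ) * z.2 i‖ ≤ 3 * omega m k * ‖z‖ := by
    rw [norm_mul, Complex.norm_I, one_mul]
    calc ‖∑ i, (k i : ℂ) * z.2 i‖ ≤ ∑ i, |k i| * ‖z‖ := by
          refine norm_sum_le_of_le _ fun i _ => ?_
          rw [norm_mul, Complex.norm_real, Real.norm_eq_abs]
          gcongr
          exact (norm_le_pi_norm z.2 i).trans (norm_snd_le z)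
      _ = (∑ i, |k i|) * ‖z‖ := by rw [Finset.sum_mul]
      _ ≤ 3 * omega m k * ‖z‖ := by
          gcongr
          exact sum_abs_le_omega m k
  linarith [norm_add_le (-Complex.I * (omega m k : ℂ) * z.1) (Complex.I * ∑ i, (k i : ℂ) * z.2 i)]

/-- The function `−Im z₀ − |Im z⃗|`, positive exactly on the tube. -/
noncomputable def depth (z : ℂ × (Fin 3 → ℂ)) : ℝ :=
  -z.1.im - Real.sqrt (∑ i, (z.2 i).im ^ 2)

lemma continuous_depth : Continuous depth := by
  unfold depth
  fun_prop

lemma depth_pos {z : ℂ × (Fin 3 → ℂ)} (hz : z ∈ tube) : 0 < depth z :=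
  sub_pos.2 hz

lemma re_phase_le (m : ℝ) (k : Fin 3 → ℝ) (z : ℂ × (Fin 3 → ℂ)) :
    (phase m k z).re ≤ -(depth z) * omega m k := by
  have h : (phase m k z).re = omega m k * z.1.im + ∑ i, k i * (-(z.2 i).im) := by
    simp [phase_apply, Complex.mul_re, Complex.mul_im]
  have hcs := Real.sum_mul_le_sqrt_mul_sqrt Finset.univ k fun i => -(z.2 i).im
  simp only [neg_sq] at hcs
  have := mul_le_mul_of_nonneg_right (sqrt_sum_sq_le_omega m k)
    (Real.sqrt_nonneg (∑ i, (z.2 i).im ^ 2))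
  rw [h, depth]
  linarith

/-- The one-particle integrand `e^{−iω(k)z₀ + i⟨k, z⃗⟩} / ω(k)`. -/
noncomputable def planeWave (m : ℝ) (z : ℂ × (Fin 3 → ℂ)) (k : Fin 3 → ℝ) : ℂ :=
  Complex.exp (phase m k z) / (omega m k : ℂ)

lemma norm_planeWave_le {m : ℝ} (z : ℂ × (Fin 3 → ℂ)) (k : Fin 3 → ℝ) :
    ‖planeWave m z k‖ ≤ Real.exp (-(depth z) * omega m k) / omega m k := by
  have hω : 0 ≤ omega m k := Real.sqrt_nonneg _
  rw [planeWave, norm_div, Complex.norm_exp, Complex.norm_real, Real.norm_of_nonneg hω]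
  gcongr
  exact re_phase_le m k z

lemma continuous_planeWave {m : ℝ} (hm : 0 < m) (z : ℂ × (Fin 3 → ℂ)) :
    Continuous (planeWave m z) := by
  have h1 := continuous_omega m
  have h2 : Continuous fun k => phase m k z := (continuous_phase m).clm_apply continuous_const
  have h3 (k) : (omega m k : ℂ) ≠ 0 :=
    Complex.ofReal_ne_zero.2 (hm.trans_le (mass_le_omega m k)).ne'
  unfold planeWave
  exact (Complex.continuous_exp.comp h2).div (Complex.continuous_ofReal.comp h1) h3

lemma integrable_planeWave {m : ℝ} (hm : 0 < m) {z : ℂ × (Fin 3 → ℂ)} (hz : z ∈ tube) :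
    Integrable (planeWave m z) := by
  refine ((integrable_exp_neg_mul_omega m (depth_pos hz)).div_const m).mono'
    (continuous_planeWave hm z).aestronglyMeasurable (ae_of_all _ fun k => ?_)
  refine (norm_planeWave_le z k).trans ?_
  gcongr
  exact mass_le_omega m k

lemma hasFDerivAt_planeWave (m : ℝ) (z : ℂ × (Fin 3 → ℂ)) (k : Fin 3 → ℝ) :
    HasFDerivAt (fun z => planeWave m z k) (planeWave m z k • phase m k) z := by
  have h := ((phase m k).hasFDerivAt (x := z)).cexp.mul_const ((omega m k : ℂ)⁻¹)
  simpa only [planeWave, div_eq_mul_inv, smul_smul, mul_comm] using h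

lemma differentiableAt_integral_planeWave {m : ℝ} (hm : 0 < m) {z : ℂ × (Fin 3 → ℂ)}
    (hz : z ∈ tube) : DifferentiableAt ℂ (fun z => ∫ k, planeWave m z k) z := by
  have hs : {w | depth z / 2 < depth w} ∈ nhds z :=
    (isOpen_lt continuous_const continuous_depth).mem_nhds (half_lt_self (depth_pos hz))
  refine (hasFDerivAt_integral_of_dominated_of_fderiv_le
    (F := planeWave m) (F' := fun w k => planeWave m w k • phase m k)
    (bound := fun k => Real.exp (-(depth z / 2) * omega m k) * 4) hs
    (.of_forall fun w => (continuous_planeWave hm w).aestronglyMeasurable)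
    (integrable_planeWave hm hz)
    ((continuous_planeWave hm z).smul (continuous_phase m)).aestronglyMeasurable
    (ae_of_all _ fun k w hw => ?_)
    ((integrable_exp_neg_mul_omega m (half_pos (depth_pos hz))).mul_const 4)
    (ae_of_all _ fun k w _ => hasFDerivAt_planeWave m w k)).differentiableAt
  have hω : 0 < omega m k := hm.trans_le (mass_le_omega m k)
  rw [norm_smul]
  calc ‖planeWave m w k‖ * ‖phase m k‖
      ≤ Real.exp (-(depth w) * omega m k) / omega m k * (4 * omega m k) := by
        gcongr
        exacts [norm_planeWave_le w k, norm_phase_le m k]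
    _ = Real.exp (-(depth w) * omega m k) * 4 := by field_simp
    _ ≤ Real.exp (-(depth z / 2) * omega m k) * 4 := by
        have : depth z / 2 < depth w := hw
        gcongr

lemma twoParticle_integrand_eq (m : ℝ) (z w : ℂ × (Fin 3 → ℂ)) :
    (fun kp : (Fin 3 → ℝ) × (Fin 3 → ℝ) =>
      Complex.exp (-Complex.I * (omega m kp.1 : ℂ) * z.1 +
          Complex.I * ∑ i, (kp.1 i : ℂ) * z.2 i) *
        Complex.exp (-Complex.I * (omega m kp.2 : ℂ) * w.1 +
          Complex.I * ∑ i, (kp.2 i : ℂ) * w.2 i) /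
        (4 * (omega m kp.1 : ℂ) * (omega m kp.2 : ℂ))) =
      fun kp => 4⁻¹ * (planeWave m z kp.1 * planeWave m w kp.2) := by
  funext kp
  simp only [planeWave, phase_apply, div_eq_mul_inv, mul_inv]
  ring

lemma f₂Ana_eq (m : ℝ) (z w : ℂ × (Fin 3 → ℂ)) :
    f₂Ana m z w = ((((2 * Real.pi) ^ 6)⁻¹ : ℝ) : ℂ) *
      (4⁻¹ * ((∫ k, planeWave m z k) * ∫ p, planeWave m w p)) := by
  rw [f₂Ana, twoParticle_integrand_eq, integral_const_mul, Measure.volume_eq_prod,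
    integral_prod_mul]

end FreeField

open FreeField

/-- For every `(z, w) ∈ T × T` the integrand defining `f₂` is Lebesgue integrable on
`ℝ³ × ℝ³`, and `f₂` is holomorphic on the open set `T × T ⊆ ℂ⁸`. -/
theorem f₂Ana_integrable_and_holomorphic (m : ℝ) (hm : 0 < m) :
    (∀ z ∈ tube, ∀ w ∈ tube, Integrable (fun kp : (Fin 3 → ℝ) × (Fin 3 → ℝ) =>
      Complex.exp (-Complex.I * (omega m kp.1 : ℂ) * z.1 +
          Complex.I * ∑ i, (kp.1 i : ℂ) * z.2 i) *
        Complex.exp (-Complex.I * (omega m kp.2 : ℂ) * w.1 +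
          Complex.I * ∑ i, (kp.2 i : ℂ) * w.2 i) /
        (4 * (omega m kp.1 : ℂ) * (omega m kp.2 : ℂ)))) ∧
    DifferentiableOn ℂ (fun zw : (ℂ × (Fin 3 → ℂ)) × (ℂ × (Fin 3 → ℂ)) =>
      f₂Ana m zw.1 zw.2) (tube ×ˢ tube) := by
  refine ⟨fun z hz w hw => ?_, ?_⟩
  · rw [twoParticle_integrand_eq]
    exact ((integrable_planeWave hm hz).mul_prod (integrable_planeWave hm hw)).const_mul _
  · rintro ⟨z, w⟩ ⟨hz, hw⟩
    simp only [f₂Ana_eq]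
    have h1 := (differentiableAt_integral_planeWave hm hz).comp (z, w) differentiableAt_fst
    have h2 := (differentiableAt_integral_planeWave hm hw).comp (z, w) differentiableAt_snd
    exact (((h1.mul h2).const_mul _).const_mul _).differentiableWithinAt
end
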